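/- arXiv:2505.12282 — 5 statements merged into one kernel-verified Lean document; each statement's English description precedes it below -/
import Mathlib

section
/- Let m ≥ 1, let w ∈ ℝ^m satisfy 0 < w_i ≤ 1 for all i, and let θ ∈ ℝ^m satisfy θ_i > 0 for all i. Set μ := min_{1 ≤ i ≤ m} θ_i / w_i and let P ∈ {1, …, m} be the number of indices i at which this minimum is attained. Then there is a constant C > 0 (depending only on m, w, θ) such that for all real J ≥ 1, ∑_{j ∈ ℕ₀^m, j·w > J} 2^{−j·θ} ≤ C · 2^{−J μ} · J^{P−1}, where j·w = ∑_{i=1}^m j_i w_i and j·θ = ∑_{i=1}^m j_i θ_i. (This is the quantitative tail sum estimate that yields the convergence rate in Theorem 3.1.) -/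
/-- The geometric series `∑ 2^{-kc}` with values in `ℝ≥0∞`. -/
theorem tsum_ofReal_two_rpow_neg_mul {c : ℝ} (hc : 0 < c) :
    ∑' k : ℕ, ENNReal.ofReal ((2 : ℝ) ^ (-((k : ℝ) * c))) =
      ENNReal.ofReal ((1 - (2 : ℝ) ^ (-c))⁻¹) := by
  have h1 : (2 : ℝ) ^ (-c) < 1 := Real.rpow_lt_one_of_one_lt_of_neg one_lt_two (by linarith)
  have h0 : (0 : ℝ) ≤ (2 : ℝ) ^ (-c) := by positivity
  have h (k : ℕ) : (2 : ℝ) ^ (-((k : ℝ) * c)) = ((2 : ℝ) ^ (-c)) ^ k := by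
    rw [← Real.rpow_natCast, ← Real.rpow_mul zero_le_two]
    congr 1
    ring
  simp_rw [h]
  rw [← ENNReal.ofReal_tsum_of_nonneg (fun k => pow_nonneg h0 k)
    (summable_geometric_of_lt_one h0 h1), tsum_geometric_of_lt_one h0 h1]

/-- The multivariate geometric series `∑ 2^{-j·c}` factors into one-dimensional ones. -/
theorem tsum_ofReal_two_rpow_neg_sum_mul {n : ℕ} {c : Fin n → ℝ} (hc : ∀ i, 0 < c i) :
    ∑' j : Fin n → ℕ, ENNReal.ofReal ((2 : ℝ) ^ (-(∑ i, (j i : ℝ) * c i))) =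
      ENNReal.ofReal (∏ i, (1 - (2 : ℝ) ^ (-c i))⁻¹) := by
  induction n with
  | zero => simp
  | succ n ih =>
    have h1 : (2 : ℝ) ^ (-c 0) < 1 :=
      Real.rpow_lt_one_of_one_lt_of_neg one_lt_two (by linarith [hc 0])
    rw [← (Fin.insertNthEquiv (fun _ => ℕ) 0).tsum_eq, ENNReal.tsum_prod', Fin.prod_univ_succ,
      ENNReal.ofReal_mul (inv_nonneg.2 (by linarith)), ← tsum_ofReal_two_rpow_neg_mul (hc 0),
      ← ih fun i => hc i.succ, ← ENNReal.tsum_mul_right]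
    refine tsum_congr fun k => ?_
    rw [← ENNReal.tsum_mul_left]
    refine tsum_congr fun j => ?_
    rw [← ENNReal.ofReal_mul (by positivity), ← Real.rpow_add two_pos, Fin.sum_univ_succ]
    simp [add_comm]

/-- A tail of the geometric series `∑ 2^{-kc}`, bounded by an exponential in the cut-off. -/
theorem tsum_ite_ofReal_two_rpow_le {μ w s : ℝ} (hw : 0 < w) (hμ : 0 < μ)
    (hs : 0 ≤ s) (hsμ : s ≤ μ) (T : ℝ) :
    ∑' k : ℕ, (if T < k * w then ENNReal.ofReal ((2 : ℝ) ^ (-((k : ℝ) * (μ * w)))) else 0) ≤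
      ENNReal.ofReal ((1 - (2 : ℝ) ^ (-(μ * w)))⁻¹) * ENNReal.ofReal ((2 : ℝ) ^ (-(s * T))) := by
  obtain ⟨N, hN, hlt⟩ : ∃ N : ℕ, T ≤ N * w ∧ ∀ k < N, (k : ℝ) * w ≤ T :=
    ⟨⌈T / w⌉₊, (div_le_iff₀ hw).1 (Nat.le_ceil _),
      fun k hk => (le_div_iff₀ hw).1 (Nat.lt_ceil.1 hk).le⟩
  rw [← (ENNReal.summable.sum_add_tsum_nat_add' (k := N)), Finset.sum_eq_zero, zero_add,
    ← tsum_ofReal_two_rpow_neg_mul (mul_pos hμ hw), ← ENNReal.tsum_mul_right]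
  · refine ENNReal.tsum_le_tsum fun k => ?_
    split_ifs
    · rw [← ENNReal.ofReal_mul (by positivity), ← Real.rpow_add two_pos]
      refine ENNReal.ofReal_le_ofReal (Real.rpow_le_rpow_of_exponent_le one_le_two ?_)
      push_cast
      have h0 : (0 : ℝ) ≤ N * w := by positivity
      have h1 := (mul_le_mul_of_nonneg_left hN hs).trans (mul_le_mul_of_nonneg_right hsμ h0)
      linarith
    · exact zero_le
  · intro k hk
    exact if_neg (hlt k (Finset.mem_range.1 hk)).not_gt

/-- Summing out a coordinate `p` with `θ p = μ * w p` bounds the tail by a product. -/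
theorem tsum_ite_sum_mul_ofReal_le {n : ℕ} {w θ : Fin (n + 1) → ℝ} {μ s : ℝ} (p : Fin (n + 1))
    (hw : 0 < w p) (hμ : 0 < μ) (hp : θ p = μ * w p) (hs : 0 ≤ s) (hsμ : s ≤ μ)
    (hc : ∀ i, 0 < θ (p.succAbove i) - s * w (p.succAbove i)) (J : ℝ) :
    ∑' j : Fin (n + 1) → ℕ, (if J < ∑ i, (j i : ℝ) * w i then
        ENNReal.ofReal ((2 : ℝ) ^ (-(∑ i, (j i : ℝ) * θ i))) else 0) ≤
      ENNReal.ofReal ((1 - (2 : ℝ) ^ (-θ p))⁻¹ * (2 : ℝ) ^ (-(s * J)) *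
        ∏ i, (1 - (2 : ℝ) ^ (-(θ (p.succAbove i) - s * w (p.succAbove i))))⁻¹) := by
  have h1 : (2 : ℝ) ^ (-θ p) < 1 :=
    Real.rpow_lt_one_of_one_lt_of_neg one_lt_two (by rw [hp]; linarith [mul_pos hμ hw])
  have h1' : 0 ≤ (1 - (2 : ℝ) ^ (-θ p))⁻¹ := inv_nonneg.2 (by linarith)
  rw [← (Fin.insertNthEquiv (fun _ => ℕ) p).tsum_eq, ENNReal.tsum_prod', ENNReal.tsum_comm,
    ENNReal.ofReal_mul (by positivity), ← tsum_ofReal_two_rpow_neg_sum_mul hc,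
    ← ENNReal.tsum_mul_left]
  refine ENNReal.tsum_le_tsum fun j => ?_
  set S := ∑ i, (j i : ℝ) * w (p.succAbove i) with hS
  set R := ∑ i, (j i : ℝ) * θ (p.succAbove i) with hR
  have hkey := mul_le_mul_left
    (tsum_ite_ofReal_two_rpow_le hw hμ hs hsμ (J - S)) (ENNReal.ofReal ((2 : ℝ) ^ (-R)))
  rw [← ENNReal.tsum_mul_right] at hkey
  refine (le_of_eq (tsum_congr fun k => ?_)).trans (hkey.trans (le_of_eq ?_))
  · simp only [Fin.insertNthEquiv_apply, Fin.sum_univ_succAbove _ p, Fin.insertNth_apply_same,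
      Fin.insertNth_apply_succAbove, ← hS, ← hR, sub_lt_iff_lt_add]
    split_ifs
    · rw [← ENNReal.ofReal_mul (by positivity), ← Real.rpow_add two_pos, hp]
      congr 2
      ring
    · simp
  · have hsum : ∑ i, (j i : ℝ) * (θ (p.succAbove i) - s * w (p.succAbove i)) = R - s * S := by
      rw [hR, hS, Finset.mul_sum, ← Finset.sum_sub_distrib]
      exact Finset.sum_congr rfl fun i _ => by ring
    rw [hsum, ← hp, ← ENNReal.ofReal_mul h1', ← ENNReal.ofReal_mul (by positivity),
      ← ENNReal.ofReal_mul (by positivity), mul_assoc, mul_assoc, ← Real.rpow_add two_pos,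
      ← Real.rpow_add two_pos]
    congr 3
    ring

/-- The geometric series with exponent `x / J` grows at most linearly in `J`. -/
theorem inv_one_sub_two_rpow_neg_div_le {x J : ℝ} (hx : 0 < x) (hJ : 1 ≤ J) :
    (1 - (2 : ℝ) ^ (-(x / J)))⁻¹ ≤ (1 - (2 : ℝ) ^ (-x))⁻¹ * J := by
  have hJ0 : 0 < J := by linarith
  have h1 : (2 : ℝ) ^ (-x) < 1 := Real.rpow_lt_one_of_one_lt_of_neg one_lt_two (by linarith)
  have h0 : (0 : ℝ) < (2 : ℝ) ^ (-x) := by positivity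
  have hb := rpow_one_add_le_one_add_mul_self (s := (2 : ℝ) ^ (-x) - 1) (by linarith)
    (inv_nonneg.2 hJ0.le) (inv_le_one_of_one_le₀ hJ)
  rw [add_sub_cancel, ← Real.rpow_mul zero_le_two, neg_mul, ← div_eq_mul_inv] at hb
  calc (1 - (2 : ℝ) ^ (-(x / J)))⁻¹ ≤ ((1 - (2 : ℝ) ^ (-x)) * J⁻¹)⁻¹ :=
        inv_anti₀ (mul_pos (by linarith) (inv_pos.2 hJ0)) (by linarith)
    _ = (1 - (2 : ℝ) ^ (-x))⁻¹ * J := by rw [mul_inv, inv_inv]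

/-- Tail sum estimate for the sparse grid projection error:
if `0 < w i ≤ 1`, `θ i > 0`, `μ = min_i θ i / w i` is attained `P` times, then
`∑_{j·w > J} 2^{-j·θ} ≲ 2^{-Jμ} J^{P-1}` for all `J ≥ 1`. -/
theorem sparse_grid_tail_sum_estimate
    (m : ℕ) (hm : 1 ≤ m) (w θ : Fin m → ℝ)
    (hw : ∀ i, 0 < w i ∧ w i ≤ 1) (hθ : ∀ i, 0 < θ i)
    (μ : ℝ) (hμ_le : ∀ i, μ ≤ θ i / w i) (hμ_mem : ∃ i, θ i / w i = μ)
    (P : ℕ) (hP : P = (Finset.univ.filter fun i => θ i / w i = μ).card) :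
    ∃ C : ℝ, 0 < C ∧ ∀ J : ℝ, 1 ≤ J →
      ∑' j : {j : Fin m → ℕ // J < ∑ i, (j i : ℝ) * w i},
          (2 : ℝ) ^ (-(∑ i, (j.1 i : ℝ) * θ i)) ≤
        C * (2 : ℝ) ^ (-(J * μ)) * J ^ (P - 1) := by
  obtain ⟨n, rfl⟩ : ∃ n, m = n + 1 := ⟨m - 1, by omega⟩
  obtain ⟨p, hp⟩ := hμ_mem
  have hμ : 0 < μ := hp ▸ div_pos (hθ p) (hw p).1
  have hθp : θ p = μ * w p := by rw [← hp, div_mul_cancel₀ _ (hw p).1.ne']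
  have hlt {x : ℝ} (hx : 0 < x) : 0 < 1 - (2 : ℝ) ^ (-x) :=
    sub_pos.2 (Real.rpow_lt_one_of_one_lt_of_neg one_lt_two (by linarith))
  let K : Fin (n + 1) → ℝ := fun i =>
    if θ i / w i = μ then (1 - (2 : ℝ) ^ (-(μ * w i)))⁻¹
    else (1 - (2 : ℝ) ^ (-(θ i - μ * w i)))⁻¹
  have hδ (i) (hi : θ i / w i ≠ μ) : 0 < θ i - μ * w i :=
    sub_pos.2 ((lt_div_iff₀ (hw i).1).1 (lt_of_le_of_ne (hμ_le i) (Ne.symm hi)))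
  have hK (i) : 0 < K i := by
    simp only [K]
    split_ifs with hi
    · exact inv_pos.2 (hlt (mul_pos hμ (hw i).1))
    · exact inv_pos.2 (hlt (hδ i hi))
  have hprod : 0 < ∏ i, K (p.succAbove i) := Finset.prod_pos fun i _ => hK _
  have hA := inv_pos.2 (hlt (hθ p))
  refine ⟨(1 - (2 : ℝ) ^ (-θ p))⁻¹ * (2 : ℝ) ^ μ * ∏ i, K (p.succAbove i), by positivity,
    fun J hJ => ?_⟩
  have hJ0 : 0 < J := by linarith
  have hcard : ∏ i, (if θ (p.succAbove i) / w (p.succAbove i) = μ then J else 1) =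
      J ^ (P - 1) := by
    have h : ∏ i, (if θ i / w i = μ then J else 1) = J ^ P := by
      rw [Finset.prod_ite, Finset.prod_const, Finset.prod_const_one, mul_one, hP]
    have hP0 : 0 < P := hP ▸ Finset.card_pos.2 ⟨p, by simp [hp]⟩
    rw [Fin.prod_univ_succAbove _ p, if_pos hp, ← mul_pow_sub_one hP0.ne'] at h
    exact mul_left_cancel₀ hJ0.ne' h
  set s := μ - μ / J with hs
  have hμJ : μ / J ≤ μ := div_le_self hμ.le hJ
  have hμJ0 : 0 < μ / J := div_pos hμ hJ0
  have hc_eq (i) : θ i - s * w i = (θ i - μ * w i) + μ * w i / J := by rw [hs]; ring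
  have hc (i) : 0 < θ i - s * w i := by
    have h1 := (le_div_iff₀ (hw i).1).1 (hμ_le i)
    have h2 : 0 < μ * w i / J := div_pos (mul_pos hμ (hw i).1) hJ0
    linarith [hc_eq i]
  have hfactor (i) : (1 - (2 : ℝ) ^ (-(θ i - s * w i)))⁻¹ ≤
      K i * (if θ i / w i = μ then J else 1) := by
    simp only [K]
    split_ifs with hi
    · have : θ i = μ * w i := by rw [← hi, div_mul_cancel₀ _ (hw i).1.ne']
      rw [hc_eq, ← this, sub_self, zero_add]
      exact inv_one_sub_two_rpow_neg_div_le (hθ i) hJ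
    · rw [mul_one]
      refine inv_anti₀ (hlt (hδ i hi)) (sub_le_sub_left
        (Real.rpow_le_rpow_of_exponent_le one_le_two ?_) _)
      have h2 : 0 < μ * w i / J := div_pos (mul_pos hμ (hw i).1) hJ0
      linarith [hc_eq i]
  have hbound : (1 - (2 : ℝ) ^ (-θ p))⁻¹ * (2 : ℝ) ^ (-(s * J)) *
        ∏ i, (1 - (2 : ℝ) ^ (-(θ (p.succAbove i) - s * w (p.succAbove i))))⁻¹ ≤
      (1 - (2 : ℝ) ^ (-θ p))⁻¹ * (2 : ℝ) ^ μ * (∏ i, K (p.succAbove i)) *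
        (2 : ℝ) ^ (-(J * μ)) * J ^ (P - 1) := by
    have he : (2 : ℝ) ^ (-(s * J)) = (2 : ℝ) ^ μ * (2 : ℝ) ^ (-(J * μ)) := by
      rw [← Real.rpow_add two_pos, hs, sub_mul, div_mul_cancel₀ _ hJ0.ne']
      congr 1
      ring
    calc _ ≤ (1 - (2 : ℝ) ^ (-θ p))⁻¹ * (2 : ℝ) ^ (-(s * J)) *
          ((∏ i, K (p.succAbove i)) * J ^ (P - 1)) := by
          rw [← hcard, ← Finset.prod_mul_distrib]
          exact mul_le_mul_of_nonneg_left (Finset.prod_le_prod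
            (fun i _ => inv_nonneg.2 (hlt (hc _)).le) fun i _ => hfactor _) (by positivity)
      _ = _ := by rw [he]; ring
  refine tsum_le_of_sum_le' (by positivity) fun t => ?_
  rw [← ENNReal.ofReal_le_ofReal_iff (by positivity),
    ENNReal.ofReal_sum_of_nonneg fun _ _ => by positivity]
  refine (ENNReal.sum_le_tsum t).trans (le_trans (le_of_eq ?_) ((tsum_ite_sum_mul_ofReal_le
    p (hw p).1 hμ hθp (by linarith) (by linarith) (fun i => hc _) J).trans
      (ENNReal.ofReal_le_ofReal hbound)))
  refine (tsum_subtype {j : Fin (n + 1) → ℕ | J < ∑ i, (j i : ℝ) * w i}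
    fun j => ENNReal.ofReal ((2 : ℝ) ^ (-(∑ i, (j i : ℝ) * θ i)))).trans ?_
  exact tsum_congr fun j => by simp [Set.indicator_apply]
end

section
/- Let m ≥ 1, let w ∈ ℝ^m satisfy 0 < w_i ≤ 1 for all i, and let d ∈ ℕ^m with d_i ≥ 1 for all i. Set δ := max_{1 ≤ i ≤ m} d_i / w_i and let R ∈ {1, …, m} be the number of indices i at which this maximum is attained. Define S(J) := ∑_{j ∈ ℕ₀^m, j·w ≤ J} 2^{j·d}. Then there are constants c, C > 0 (depending only on m, w, d) such that for all real J ≥ 1, c · 2^{J δ} · J^{R−1} ≤ S(J) ≤ C · 2^{J δ} · J^{R−1}. (This is the dimension count of the sparse tensor product space in Theorem 3.3, since dim 𝓗_{j_i}^{(i)} ≍ 2^{j_i d_i}.) -/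
open Finset Function

theorem sum_update_natCast_mul {ι : Type*} [Fintype ι] [DecidableEq ι] (b : ι → ℕ) (a : ι → ℝ)
    (k : ι) (n : ℕ) :
    ∑ i, (update b k n i : ℝ) * a i = ∑ i, (b i : ℝ) * a i + ((n : ℝ) - b k) * a k := by
  rw [← Finset.add_sum_erase _ _ (mem_univ k),
    ← Finset.add_sum_erase _ (fun i => (b i : ℝ) * a i) (mem_univ k)]
  have h : ∑ i ∈ univ.erase k, (update b k n i : ℝ) * a i = ∑ i ∈ univ.erase k, (b i : ℝ) * a i :=
    Finset.sum_congr rfl fun i hi => by rw [update_of_ne (Finset.ne_of_mem_erase hi)]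
  rw [h, update_self]
  ring

/-- A truncated geometric series with ratio `2 ^ (-e) ≤ 1` is bounded, or grows at most linearly
in the truncation parameter when `e = 0`. -/
theorem exists_geom_sum_le {e v : ℝ} (he : 0 ≤ e) (hv : 0 < v) :
    ∃ K : ℝ, 0 < K ∧ ∀ J : ℝ, 1 ≤ J →
      ∑ n ∈ range (⌊J / v⌋₊ + 1), (2 : ℝ) ^ (-((n : ℝ) * e)) ≤ K * (if e = 0 then J else 1) := by
  rcases he.eq_or_lt with rfl | he
  · refine ⟨1 / v + 1, by positivity, fun J hJ => ?_⟩
    have h : (⌊J / v⌋₊ : ℝ) ≤ J / v := Nat.floor_le (by positivity)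
    simp only [mul_zero, neg_zero, Real.rpow_zero, sum_const, card_range, nsmul_eq_mul, mul_one,
      if_true, Nat.cast_add, Nat.cast_one]
    have : (1 / v + 1) * J = J / v + J := by ring
    linarith
  · have hq : (2 : ℝ) ^ (-e) < 1 := Real.rpow_lt_one_of_one_lt_of_neg one_lt_two (by linarith)
    have hq0 : (0 : ℝ) ≤ (2 : ℝ) ^ (-e) := by positivity
    refine ⟨(1 - (2 : ℝ) ^ (-e))⁻¹, inv_pos.2 (by linarith), fun J _ => ?_⟩
    rw [if_neg he.ne', mul_one, ← tsum_geometric_of_lt_one hq0 hq]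
    have h : ∀ n : ℕ, (2 : ℝ) ^ (-((n : ℝ) * e)) = ((2 : ℝ) ^ (-e)) ^ n := fun n => by
      rw [← Real.rpow_natCast, ← Real.rpow_mul zero_le_two]
      ring_nf
    simp only [h]
    exact (summable_geometric_of_lt_one hq0 hq).sum_le_tsum _ fun n _ => by positivity

section

variable {ι : Type*} [Fintype ι] [DecidableEq ι] {w d : ι → ℝ} {δ : ℝ} {k : ι}

/-- The upper bound: exchanging coordinate `k` for the rounded slack
`⌊(J - j·w) / w k⌋₊` turns the sum into a product of truncated geometric series. -/
theorem exists_sum_two_rpow_le (hw : ∀ i, 0 < w i) (hle : ∀ i, d i ≤ w i * δ)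
    (hk : d k = w k * δ) (hdk : 0 < d k) :
    ∃ C : ℝ, 0 < C ∧ ∀ (J : ℝ) (s : Finset (ι → ℕ)), 1 ≤ J →
      (∀ j ∈ s, ∑ i, (j i : ℝ) * w i ≤ J) →
      ∑ j ∈ s, (2 : ℝ) ^ (∑ i, (j i : ℝ) * d i) ≤
        C * (2 : ℝ) ^ (J * δ) * J ^ #((univ.filter fun i => d i = w i * δ).erase k) := by
  set e : ι → ℝ := update (fun i => w i * δ - d i) k (d k) with he
  have hek : e k = d k := update_self ..
  have hei : ∀ i, i ≠ k → e i = w i * δ - d i := fun i hi => update_of_ne hi ..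
  have he0 : ∀ i, 0 ≤ e i := fun i => by
    rcases eq_or_ne i k with rfl | hi
    · rw [hek]; exact hdk.le
    · rw [hei i hi]; linarith [hle i]
  have hT : ∀ i, e i = 0 ↔ i ∈ ((univ.filter fun i => d i = w i * δ).erase k) := fun i => by
    rcases eq_or_ne i k with rfl | hi
    · simp [hek, hdk.ne']
    · simp [hei i hi, hi, sub_eq_zero, eq_comm]
  choose K hK0 hK using fun i => exists_geom_sum_le (he0 i) (hw i)
  refine ⟨∏ i, K i, prod_pos fun i _ => hK0 i, fun J s hJ hs => ?_⟩
  have hδ : ∀ i, (if e i = 0 then J else 1) =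
      if i ∈ ((univ.filter fun i => d i = w i * δ).erase k) then J else 1 := fun i => by simp only [hT]
  let n : (ι → ℕ) → ℕ := fun j => ⌊(J - ∑ i, (j i : ℝ) * w i) / w k⌋₊
  have hslack : ∀ j ∈ s, 0 ≤ (J - ∑ i, (j i : ℝ) * w i) / w k := fun j hj =>
    div_nonneg (by linarith [hs j hj]) (hw k).le
  have hn : ∀ j ∈ s, (n j : ℝ) * w k ≤ J - ∑ i, (j i : ℝ) * w i := fun j hj => by
    rw [← le_div_iff₀ (hw k)]
    exact Nat.floor_le (hslack j hj)
  have hnonneg : ∀ (j : ι → ℕ) i, 0 ≤ (j i : ℝ) * w i := fun j i =>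
    mul_nonneg (Nat.cast_nonneg _) (hw i).le
  let φ : (ι → ℕ) → ι → ℕ := fun j => update j k (n j)
  have hinj : Set.InjOn φ s := by
    intro a ha b hb hab
    have hoff : ∀ i, i ≠ k → a i = b i := fun i hi => by
      simpa [φ, hi] using congrFun hab i
    have hnab : n a = n b := by simpa [φ] using congrFun hab k
    have hak : a = update b k (a k) := by
      ext i
      rcases eq_or_ne i k with rfl | hi
      · simp
      · simp [hi, hoff i hi]
    have hsum : ∑ i, (a i : ℝ) * w i = ∑ i, (b i : ℝ) * w i + ((a k : ℝ) - b k) * w k := by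
      rw [← sum_update_natCast_mul, ← hak]
    have hfl : n a + a k = n b + b k := by
      rw [← Nat.floor_add_natCast (hslack a ha), ← Nat.floor_add_natCast (hslack b hb), hsum]
      congr 1
      have := (hw k).ne'
      field_simp
      ring
    rw [hak, show a k = b k by omega, update_eq_self]
  have hterm : ∀ j ∈ s, (2 : ℝ) ^ (∑ i, (j i : ℝ) * d i) ≤
      2 ^ (J * δ) * ∏ i, (2 : ℝ) ^ (-((φ j i : ℝ) * e i)) := fun j hj => by
    rw [← Real.rpow_sum_of_pos two_pos, ← Real.rpow_add two_pos]
    refine Real.rpow_le_rpow_of_exponent_le one_le_two ?_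
    have h1 : ∑ i, (j i : ℝ) * e i = (∑ i, (j i : ℝ) * w i) * δ - ∑ i, (j i : ℝ) * d i
        + j k * d k := by
      rw [← Finset.add_sum_erase _ _ (mem_univ k), hek, sum_mul, ← sum_sub_distrib,
        ← Finset.add_sum_erase _ (fun i => (j i : ℝ) * w i * δ - (j i : ℝ) * d i) (mem_univ k),
        sum_congr rfl fun i hi => by rw [hei i (ne_of_mem_erase hi)], hk]
      simp only [mul_sub, mul_assoc]
      ring
    rw [sum_neg_distrib, sum_update_natCast_mul, h1, hek]
    have hδ0 : 0 < δ := pos_of_mul_pos_right (hk ▸ hdk) (hw k).le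
    have := mul_le_mul_of_nonneg_right (hn j hj) hδ0.le
    rw [mul_assoc, ← hk] at this
    linarith
  have hmaps : s.image φ ⊆ Fintype.piFinset fun i => range (⌊J / w i⌋₊ + 1) := by
    intro b hb
    obtain ⟨j, hj, rfl⟩ := mem_image.1 hb
    refine Fintype.mem_piFinset.2 fun i => mem_range.2 (Nat.lt_succ_of_le ?_)
    rcases eq_or_ne i k with rfl | hi
    · simp only [φ, update_self]
      refine Nat.floor_le_floor (div_le_div_of_nonneg_right ?_ (hw i).le)
      linarith [sum_nonneg fun i (_ : i ∈ univ) => hnonneg j i]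
    · simp only [φ, update_of_ne hi]
      rw [Nat.le_floor_iff (div_nonneg (by linarith) (hw i).le), le_div_iff₀ (hw i)]
      exact (single_le_sum (fun i _ => hnonneg j i) (mem_univ i)).trans (hs j hj)
  calc ∑ j ∈ s, (2 : ℝ) ^ (∑ i, (j i : ℝ) * d i)
      ≤ ∑ j ∈ s, 2 ^ (J * δ) * ∏ i, (2 : ℝ) ^ (-((φ j i : ℝ) * e i)) := sum_le_sum hterm
    _ = 2 ^ (J * δ) * ∑ b ∈ s.image φ, ∏ i, (2 : ℝ) ^ (-((b i : ℝ) * e i)) := by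
      rw [sum_image hinj, mul_sum]
    _ ≤ 2 ^ (J * δ) * ∑ b ∈ Fintype.piFinset fun i => range (⌊J / w i⌋₊ + 1),
          ∏ i, (2 : ℝ) ^ (-((b i : ℝ) * e i)) := by
      gcongr
    _ = 2 ^ (J * δ) * ∏ i, ∑ n ∈ range (⌊J / w i⌋₊ + 1), (2 : ℝ) ^ (-((n : ℝ) * e i)) := by
      rw [prod_univ_sum]
    _ ≤ 2 ^ (J * δ) * ∏ i, (K i * if e i = 0 then J else 1) := by
      gcongr with i
      exact hK i J hJ
    _ = _ := by
      simp only [hδ, prod_mul_distrib, prod_ite_mem, univ_inter, prod_const]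
      ring

/-- The lower bound: fill the coordinates of maximal ratio other than `k` freely up to
`J / |ι|`, and let coordinate `k` use up the remaining budget. -/
theorem exists_le_sum_two_rpow (hw : ∀ i, 0 < w i) (hw1 : ∀ i, w i ≤ 1)
    (hk : d k = w k * δ) (hdk : 0 < d k) :
    ∃ c : ℝ, 0 < c ∧ ∀ (J : ℝ) (s : Finset (ι → ℕ)), 1 ≤ J →
      (∀ j : ι → ℕ, ∑ i, (j i : ℝ) * w i ≤ J → j ∈ s) →
      c * (2 : ℝ) ^ (J * δ) * J ^ #((univ.filter fun i => d i = w i * δ).erase k) ≤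
        ∑ j ∈ s, (2 : ℝ) ^ (∑ i, (j i : ℝ) * d i) := by
  set T : Finset ι := (univ.filter fun i => d i = w i * δ).erase k with hTdef
  have hkT : k ∉ T := by simp [hTdef]
  have hT : ∀ i ∈ T, d i = w i * δ := fun i hi => by
    exact (mem_filter.1 (mem_of_mem_erase hi)).2
  have hδ0 : 0 < δ := pos_of_mul_pos_right (hk ▸ hdk) (hw k).le
  have hcard : (0 : ℝ) < Fintype.card ι := by
    exact_mod_cast Fintype.card_pos_iff.2 ⟨k⟩
  refine ⟨2 ^ (-d k) * ((Fintype.card ι : ℝ)⁻¹) ^ #T, by positivity, fun J s hJ hs => ?_⟩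
  set N : ℕ := ⌊J / Fintype.card ι⌋₊
  let B : Finset (ι → ℕ) := Fintype.piFinset fun i => if i ∈ T then range (N + 1) else {0}
  have hB0 : ∀ b ∈ B, ∀ i, i ∉ T → b i = 0 := fun b hb i hi => by
    simpa [hi] using Fintype.mem_piFinset.1 hb i
  have hBN : ∀ b ∈ B, ∀ i, b i ≤ N := fun b hb i => by
    by_cases hi : i ∈ T
    · have h := Fintype.mem_piFinset.1 hb i
      rw [if_pos hi, mem_range] at h
      omega
    · simp [hB0 b hb i hi]
  have hBsum : ∀ b ∈ B, ∑ i, (b i : ℝ) * w i ≤ J := fun b hb => by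
    calc ∑ i, (b i : ℝ) * w i ≤ ∑ _i : ι, J / Fintype.card ι := by
          refine sum_le_sum fun i _ => ?_
          have h1 : (b i : ℝ) ≤ J / Fintype.card ι :=
            (Nat.cast_le.2 (hBN b hb i)).trans (Nat.floor_le (by positivity))
          nlinarith [hw i, hw1 i, Nat.cast_nonneg (α := ℝ) (b i)]
      _ = J := by
          rw [sum_const, card_univ, nsmul_eq_mul]
          field_simp
  have hBd : ∀ b ∈ B, ∑ i, (b i : ℝ) * d i = (∑ i, (b i : ℝ) * w i) * δ := fun b hb => by
    rw [sum_mul]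
    refine sum_congr rfl fun i _ => ?_
    by_cases hi : i ∈ T
    · rw [hT i hi, mul_assoc]
    · simp [hB0 b hb i hi]
  let n : (ι → ℕ) → ℕ := fun b => ⌊(J - ∑ i, (b i : ℝ) * w i) / w k⌋₊
  let φ : (ι → ℕ) → ι → ℕ := fun b => update b k (n b)
  have hinj : Set.InjOn φ B := by
    intro a ha b hb hab
    ext i
    rcases eq_or_ne i k with rfl | hi
    · rw [hB0 a ha i hkT, hB0 b hb i hkT]
    · simpa [φ, hi] using congrFun hab i
  have hmaps : B.image φ ⊆ s := by
    intro j hj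
    obtain ⟨b, hb, rfl⟩ := mem_image.1 hj
    refine hs _ ?_
    have h : (n b : ℝ) * w k ≤ J - ∑ i, (b i : ℝ) * w i := by
      rw [← le_div_iff₀ (hw k)]
      exact Nat.floor_le (div_nonneg (by linarith [hBsum b hb]) (hw k).le)
    rw [sum_update_natCast_mul, hB0 b hb k hkT]
    push_cast
    linarith
  have hterm : ∀ b ∈ B, (2 : ℝ) ^ (-d k) * 2 ^ (J * δ) ≤
      (2 : ℝ) ^ (∑ i, (φ b i : ℝ) * d i) := fun b hb => by
    rw [← Real.rpow_add two_pos]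
    refine Real.rpow_le_rpow_of_exponent_le one_le_two ?_
    have h : J - ∑ i, (b i : ℝ) * w i ≤ ((n b : ℝ) + 1) * w k := by
      rw [← div_le_iff₀ (hw k)]
      exact (Nat.lt_floor_add_one _).le
    have := mul_le_mul_of_nonneg_right h hδ0.le
    rw [mul_assoc, ← hk] at this
    rw [sum_update_natCast_mul, hB0 b hb k hkT, hBd b hb]
    push_cast
    linarith
  have hBcard : #B = (N + 1) ^ #T := by
    simp only [B, Fintype.card_piFinset, apply_ite card, card_range, card_singleton, prod_ite_mem,
      univ_inter, prod_const]
  calc (2 : ℝ) ^ (-d k) * ((Fintype.card ι : ℝ)⁻¹) ^ #T * 2 ^ (J * δ) * J ^ #T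
      = (J / Fintype.card ι) ^ #T * (2 ^ (-d k) * 2 ^ (J * δ)) := by
        rw [div_eq_mul_inv, mul_pow]
        ring
    _ ≤ ((N : ℝ) + 1) ^ #T * (2 ^ (-d k) * 2 ^ (J * δ)) := by
        gcongr
        exact (Nat.lt_floor_add_one _).le
    _ = ∑ _b ∈ B, (2 : ℝ) ^ (-d k) * 2 ^ (J * δ) := by
        rw [sum_const, hBcard, nsmul_eq_mul]
        push_cast
        rfl
    _ ≤ ∑ b ∈ B, (2 : ℝ) ^ (∑ i, (φ b i : ℝ) * d i) := sum_le_sum hterm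
    _ = ∑ j ∈ B.image φ, (2 : ℝ) ^ (∑ i, (j i : ℝ) * d i) := by rw [sum_image hinj]
    _ ≤ ∑ j ∈ s, (2 : ℝ) ^ (∑ i, (j i : ℝ) * d i) :=
        sum_le_sum_of_subset_of_nonneg hmaps fun _ _ _ => by positivity

end

/-- Dimension count of the sparse tensor product space:
if `0 < w i ≤ 1`, `d i ≥ 1`, `δ = max_i d i / w i` is attained `R` times, then
`S(J) = ∑_{j·w ≤ J} 2^{j·d} ≍ 2^{Jδ} J^{R-1}` for all `J ≥ 1`. -/
theorem sparse_grid_dimension_count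
    (m : ℕ) (hm : 1 ≤ m) (w : Fin m → ℝ) (d : Fin m → ℕ)
    (hw : ∀ i, 0 < w i ∧ w i ≤ 1) (hd : ∀ i, 1 ≤ d i)
    (δ : ℝ) (hδ_le : ∀ i, (d i : ℝ) / w i ≤ δ)
    (hδ_mem : ∃ i, (d i : ℝ) / w i = δ)
    (R : ℕ) (hR : R = (Finset.univ.filter fun i => (d i : ℝ) / w i = δ).card)
    (A : ℝ → Finset (Fin m → ℕ))
    (hA : ∀ (J : ℝ) (j : Fin m → ℕ), j ∈ A J ↔ ∑ i, (j i : ℝ) * w i ≤ J) :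
    ∃ c C : ℝ, 0 < c ∧ 0 < C ∧ ∀ J : ℝ, 1 ≤ J →
      c * (2 : ℝ) ^ (J * δ) * J ^ (R - 1) ≤
          ∑ j ∈ A J, (2 : ℝ) ^ (∑ i, (j i : ℝ) * (d i : ℝ)) ∧
        ∑ j ∈ A J, (2 : ℝ) ^ (∑ i, (j i : ℝ) * (d i : ℝ)) ≤
          C * (2 : ℝ) ^ (J * δ) * J ^ (R - 1) := by
  obtain ⟨k, hk⟩ := hδ_mem
  have hwpos : ∀ i, 0 < w i := fun i => (hw i).1
  have hdk : (0 : ℝ) < d k := Nat.cast_pos.2 (hd k)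
  have hiff : ∀ i, (d i : ℝ) / w i = δ ↔ (d i : ℝ) = w i * δ := fun i => by
    rw [div_eq_iff (hwpos i).ne', mul_comm]
  have hle : ∀ i, (d i : ℝ) ≤ w i * δ := fun i => by
    rw [mul_comm, ← div_le_iff₀ (hwpos i)]
    exact hδ_le i
  have hcard : #((univ.filter fun i => (d i : ℝ) = w i * δ).erase k) = R - 1 := by
    rw [card_erase_of_mem (by simpa using (hiff k).1 hk), hR]
    simp only [hiff]
  obtain ⟨c, hc, hlow⟩ :=
    exists_le_sum_two_rpow (d := fun i => (d i : ℝ)) hwpos (fun i => (hw i).2) ((hiff k).1 hk) hdk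
  obtain ⟨C, hC, hupp⟩ :=
    exists_sum_two_rpow_le (d := fun i => (d i : ℝ)) hwpos hle ((hiff k).1 hk) hdk
  simp only [hcard] at hlow hupp
  exact ⟨c, C, hc, hC, fun J hJ =>
    ⟨hlow J (A J) hJ fun j => (hA J j).2, hupp J (A J) hJ fun j => (hA J j).1⟩⟩
end

section
/- Let m ≥ 1, w ∈ ℝ^m with 0 < w_i ≤ 1, θ ∈ ℝ^m with θ_i > 0, and d ∈ ℕ^m with d_i ≥ 1. Set μ := min_i θ_i/w_i with the minimum attained P times, δ := max_i d_i/w_i with the maximum attained R times, β := μ/δ, and N(J) := ∑_{j ∈ ℕ₀^m, j·w ≤ J} 2^{j·d}. Then there exists a constant C > 0 such that for all real J ≥ 2, 2^{−J μ} · J^{P−1} ≤ C · N(J)^{−β} · (log N(J))^{(P−1) + β(R−1)}. (This converts the level-wise error bound into the cost-complexity rate of Theorem 3.4 in terms of the number of degrees of freedom N.) -/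
/-- A truncated geometric series with ratio `2 ^ (-b)`, `b ≥ 0`, of length proportional to `J` is
bounded, or grows at most linearly in `J` when `b = 0`. -/
theorem exists_sum_range_floor_rpow_le {b v : ℝ} (hb : 0 ≤ b) (hv : 0 < v) :
    ∃ C : ℝ, 0 < C ∧ ∀ J : ℝ, 1 ≤ J →
      ∑ k ∈ Finset.range (⌊J / v⌋₊ + 1), (2 : ℝ) ^ (-(b * k)) ≤
        C * if b = 0 then J else 1 := by
  rcases hb.eq_or_lt with rfl | hb
  · refine ⟨1 / v + 1, by positivity, fun J hJ => ?_⟩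
    have := Nat.floor_le (show 0 ≤ J / v by positivity)
    simp only [zero_mul, neg_zero, Real.rpow_zero, Finset.sum_const, Finset.card_range,
      nsmul_eq_mul, mul_one, if_true]
    push_cast
    have h : (1 / v + 1) * J = J / v + J := by ring
    linarith
  · have hr : (2 : ℝ) ^ (-b) < 1 := Real.rpow_lt_one_of_one_lt_of_neg one_lt_two (by linarith)
    have hr0 : (0 : ℝ) ≤ (2 : ℝ) ^ (-b) := by positivity
    refine ⟨(1 - (2 : ℝ) ^ (-b))⁻¹, inv_pos.2 (by linarith), fun J _ => ?_⟩
    rw [if_neg hb.ne', mul_one, ← tsum_geometric_of_lt_one hr0 hr]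
    have h (k : ℕ) : (2 : ℝ) ^ (-(b * k)) = ((2 : ℝ) ^ (-b)) ^ k := by
      rw [← Real.rpow_mul_natCast (by norm_num), neg_mul]
    simp only [h]
    exact (summable_geometric_of_lt_one hr0 hr).sum_le_tsum _ fun k _ => by positivity

/-- Over boxes of side proportional to `J`, the sum of `2 ^ (-b·p)` with `b ≥ 0` grows at most like
`J` to the number of vanishing entries of `b`. -/
theorem exists_sum_piFinset_rpow_le {ι : Type*} [Fintype ι] [DecidableEq ι] {b w : ι → ℝ}
    (hb : ∀ i, 0 ≤ b i) (hw : ∀ i, 0 < w i) :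
    ∃ C : ℝ, 0 < C ∧ ∀ J : ℝ, 1 ≤ J →
      ∑ p ∈ Fintype.piFinset fun i => Finset.range (⌊J / w i⌋₊ + 1),
        (2 : ℝ) ^ (-∑ i, b i * (p i : ℝ)) ≤
          C * J ^ (Finset.univ.filter fun i => b i = 0).card := by
  choose C hC hCle using fun i => exists_sum_range_floor_rpow_le (hb i) (hw i)
  refine ⟨∏ i, C i, Finset.prod_pos fun i _ => hC i, fun J hJ => ?_⟩
  calc _ = ∏ i, ∑ k ∈ Finset.range (⌊J / w i⌋₊ + 1), (2 : ℝ) ^ (-(b i * (k : ℝ))) := by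
        rw [Finset.prod_univ_sum]
        refine Finset.sum_congr rfl fun p _ => ?_
        rw [← Finset.sum_neg_distrib, Real.rpow_sum_of_pos two_pos]
    _ ≤ ∏ i, (C i * if b i = 0 then J else 1) :=
        Finset.prod_le_prod (fun i _ => Finset.sum_nonneg fun k _ => by positivity)
          fun i _ => hCle i J hJ
    _ = _ := by
        rw [Finset.prod_mul_distrib, Finset.prod_ite, Finset.prod_const, Finset.prod_const_one,
          mul_one]

/-- Exponential sums over the simplices `j·w ≤ J`: if `δ = max_i d i / w i` is attained `R` times,
then `∑_{j·w ≤ J} 2^{j·d} ≲ 2^{δJ} J^{R-1}`. -/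
theorem exists_sum_simplex_rpow_le {ι : Type*} [Fintype ι] {w d : ι → ℝ}
    (hw : ∀ i, 0 < w i) (hd : ∀ i, 0 < d i) {δ : ℝ} (hδ_le : ∀ i, d i / w i ≤ δ)
    (hδ_mem : ∃ i, d i / w i = δ) (A : ℝ → Finset (ι → ℕ))
    (hA : ∀ (J : ℝ) (j : ι → ℕ), j ∈ A J ↔ ∑ i, (j i : ℝ) * w i ≤ J) :
    ∃ C : ℝ, 0 < C ∧ ∀ J : ℝ, 1 ≤ J →
      ∑ j ∈ A J, (2 : ℝ) ^ (∑ i, (j i : ℝ) * d i) ≤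
        C * (2 : ℝ) ^ (δ * J) * J ^ ((Finset.univ.filter fun i => d i / w i = δ).card - 1) := by
  classical
  obtain ⟨i₀, hi₀⟩ := hδ_mem
  have hδ : 0 < δ := hi₀ ▸ div_pos (hd i₀) (hw i₀)
  -- Exchange the `i₀`-th coordinate of `j` for the slack in `j·w ≤ J`, measured in units of `w i₀`.
  let b : ι → ℝ := Function.update (fun i => δ * w i - d i) i₀ (δ * w i₀)
  have hb_ne {i : ι} (hi : i ≠ i₀) : b i = δ * w i - d i := Function.update_of_ne hi _ _
  have hb_self : b i₀ = δ * w i₀ := Function.update_self _ _ _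
  have hb : ∀ i, 0 ≤ b i := by
    intro i
    rcases eq_or_ne i i₀ with rfl | hi
    · rw [hb_self]; exact (mul_pos hδ (hw _)).le
    · rw [hb_ne hi]; exact sub_nonneg.2 ((div_le_iff₀ (hw i)).1 (hδ_le i))
  have hcard : (Finset.univ.filter fun i => b i = 0).card =
      (Finset.univ.filter fun i => d i / w i = δ).card - 1 := by
    rw [← Finset.card_erase_of_mem (a := i₀) (by simpa using hi₀)]
    congr 1
    ext i
    rcases eq_or_ne i i₀ with rfl | hi
    · simpa [hb_self] using ⟨hδ.ne', (hw i).ne'⟩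
    · simp only [Finset.mem_filter_univ, Finset.mem_erase, hb_ne hi, sub_eq_zero,
        div_eq_iff (hw i).ne', ne_eq, hi, not_false_eq_true, true_and, eq_comm (a := d i)]
  obtain ⟨C, hC, hCle⟩ := exists_sum_piFinset_rpow_le hb hw
  refine ⟨C, hC, fun J hJ => ?_⟩
  let l : (ι → ℕ) → ℕ := fun j => ⌊(J - ∑ i, (j i : ℝ) * w i) / w i₀⌋₊
  let φ : (ι → ℕ) → ι → ℕ := fun j => Function.update j i₀ (l j)
  have hφ_ne (j : ι → ℕ) {i : ι} (hi : i ≠ i₀) : φ j i = j i := Function.update_of_ne hi _ _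
  have hφ_self (j : ι → ℕ) : φ j i₀ = l j := Function.update_self _ _ _
  have hslack {j : ι → ℕ} (hj : j ∈ A J) : 0 ≤ (J - ∑ i, (j i : ℝ) * w i) / w i₀ :=
    div_nonneg (sub_nonneg.2 ((hA J j).1 hj)) (hw i₀).le
  have hmaps : ∀ j ∈ A J, φ j ∈ Fintype.piFinset fun i => Finset.range (⌊J / w i⌋₊ + 1) := by
    intro j hj
    rw [Fintype.mem_piFinset]
    intro i
    rw [Finset.mem_range, Nat.lt_succ_iff]
    have hnn : ∀ i, 0 ≤ (j i : ℝ) * w i := fun i => mul_nonneg (Nat.cast_nonneg _) (hw i).le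
    rcases eq_or_ne i i₀ with rfl | hi
    · rw [hφ_self]
      refine Nat.floor_mono (div_le_div_of_nonneg_right ?_ (hw i).le)
      exact sub_le_self _ (Finset.sum_nonneg fun i _ => hnn i)
    · rw [hφ_ne j hi]
      refine Nat.le_floor ((le_div_iff₀ (hw i)).2 ?_)
      exact (Finset.single_le_sum (fun i _ => hnn i) (Finset.mem_univ i)).trans ((hA J j).1 hj)
  have hinj : Set.InjOn φ (A J) := by
    intro j hj j' hj' h
    have hne {i : ι} (hi : i ≠ i₀) : j i = j' i := by
      rw [← hφ_ne j hi, ← hφ_ne j' hi, h]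
    have hl : l j = l j' := by rw [← hφ_self, ← hφ_self, h]
    have hsum : (J - ∑ i, (j i : ℝ) * w i) / w i₀ + j i₀ =
        (J - ∑ i, (j' i : ℝ) * w i) / w i₀ + j' i₀ := by
      have := (hw i₀).ne'
      have herase : ∑ i ∈ Finset.univ.erase i₀, (j i : ℝ) * w i =
          ∑ i ∈ Finset.univ.erase i₀, (j' i : ℝ) * w i :=
        Finset.sum_congr rfl fun i hi => by rw [hne (Finset.ne_of_mem_erase hi)]
      rw [← Finset.add_sum_erase _ _ (Finset.mem_univ i₀),
        ← Finset.add_sum_erase _ (fun i => (j' i : ℝ) * w i) (Finset.mem_univ i₀), herase]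
      field_simp
      ring
    have h1 : (l j : ℝ) ≤ _ := Nat.floor_le (hslack hj)
    have h2 : _ < (l j : ℝ) + 1 := Nat.lt_floor_add_one _
    have h3 : (l j' : ℝ) ≤ _ := Nat.floor_le (hslack hj')
    have h4 : _ < (l j' : ℝ) + 1 := Nat.lt_floor_add_one _
    rw [hl] at h1 h2
    have h5 : j i₀ < j' i₀ + 1 := by
      have : (j i₀ : ℝ) < j' i₀ + 1 := by linarith
      exact_mod_cast this
    have h6 : j' i₀ < j i₀ + 1 := by
      have : (j' i₀ : ℝ) < j i₀ + 1 := by linarith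
      exact_mod_cast this
    funext i
    rcases eq_or_ne i i₀ with rfl | hi
    · omega
    · exact hne hi
  have hterm : ∀ j ∈ A J, (2 : ℝ) ^ (∑ i, (j i : ℝ) * d i) ≤
      (2 : ℝ) ^ (δ * J) * (2 : ℝ) ^ (-∑ i, b i * (φ j i : ℝ)) := by
    intro j hj
    rw [← Real.rpow_add two_pos]
    refine Real.rpow_le_rpow_of_exponent_le one_le_two ?_
    have hl : (l j : ℝ) * w i₀ ≤ J - ∑ i, (j i : ℝ) * w i :=
      (le_div_iff₀ (hw i₀)).1 (Nat.floor_le (hslack hj))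
    have hd₀ : d i₀ = δ * w i₀ := (div_eq_iff (hw i₀).ne').1 hi₀
    have hbφ : ∑ i, b i * (φ j i : ℝ) =
        δ * (l j * w i₀) + δ * ∑ i, (j i : ℝ) * w i - ∑ i, (j i : ℝ) * d i := by
      rw [Finset.mul_sum, add_sub_assoc, ← Finset.sum_sub_distrib,
        ← Finset.add_sum_erase _ _ (Finset.mem_univ i₀),
        ← Finset.add_sum_erase _ (fun i => δ * ((j i : ℝ) * w i) - j i * d i)
          (Finset.mem_univ i₀), hb_self, hφ_self, hd₀]
      have : ∑ i ∈ Finset.univ.erase i₀, b i * (φ j i : ℝ) =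
          ∑ i ∈ Finset.univ.erase i₀, (δ * ((j i : ℝ) * w i) - j i * d i) := by
        refine Finset.sum_congr rfl fun i hi => ?_
        rw [hb_ne (Finset.ne_of_mem_erase hi), hφ_ne j (Finset.ne_of_mem_erase hi)]
        ring
      rw [this]
      ring
    rw [hbφ]
    linarith [mul_le_mul_of_nonneg_left hl hδ.le]
  calc ∑ j ∈ A J, (2 : ℝ) ^ (∑ i, (j i : ℝ) * d i)
      ≤ ∑ j ∈ A J, (2 : ℝ) ^ (δ * J) * (2 : ℝ) ^ (-∑ i, b i * (φ j i : ℝ)) :=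
        Finset.sum_le_sum hterm
    _ = (2 : ℝ) ^ (δ * J) * ∑ p ∈ (A J).image φ, (2 : ℝ) ^ (-∑ i, b i * (p i : ℝ)) := by
        rw [← Finset.mul_sum, Finset.sum_image hinj]
    _ ≤ (2 : ℝ) ^ (δ * J) * (C * J ^ (Finset.univ.filter fun i => b i = 0).card) := by
        gcongr
        refine le_trans (Finset.sum_le_sum_of_subset_of_nonneg (Finset.image_subset_iff.2 hmaps)
          fun p _ _ => by positivity) (hCle J hJ)
    _ = _ := by rw [hcard]; ring

/-- The sums `∑_{j·w ≤ J} 2^{j·d}` grow at least exponentially in `J`. -/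
theorem half_mul_log_two_le_log_sum_simplex {ι : Type*} [Fintype ι] {w d : ι → ℝ} (i₀ : ι)
    (hw₀ : 0 < w i₀) (hw₁ : w i₀ ≤ 1) (hd : 1 ≤ d i₀) {J : ℝ} (hJ : 2 ≤ J)
    {s : Finset (ι → ℕ)} (hs : ∀ j : ι → ℕ, j ∈ s ↔ ∑ i, (j i : ℝ) * w i ≤ J) :
    J / 2 * Real.log 2 ≤ Real.log (∑ j ∈ s, (2 : ℝ) ^ (∑ i, (j i : ℝ) * d i)) := by
  classical
  let k : ℕ := ⌊J / w i₀⌋₊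
  have hsum (v : ι → ℝ) : ∑ i, ((Pi.single i₀ k : ι → ℕ) i : ℝ) * v i = k * v i₀ := by
    rw [Finset.sum_eq_single i₀ (fun i _ hi => by simp [hi]) (by simp), Pi.single_eq_same]
  have hmem : Pi.single i₀ k ∈ s := by
    rw [hs, hsum]
    exact (le_div_iff₀ hw₀).1 (Nat.floor_le (by positivity))
  have hk : J / 2 ≤ k := by
    have h1 : J / w i₀ < (k : ℝ) + 1 := Nat.lt_floor_add_one _
    have h2 : J ≤ J / w i₀ := le_div_self (by linarith) hw₀ hw₁
    linarith
  rw [← Real.log_rpow two_pos]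
  refine Real.log_le_log (by positivity) ?_
  calc (2 : ℝ) ^ (J / 2) ≤ (2 : ℝ) ^ (∑ i, ((Pi.single i₀ k : ι → ℕ) i : ℝ) * d i) := by
        rw [hsum]
        exact Real.rpow_le_rpow_of_exponent_le one_le_two
          (hk.trans (le_mul_of_one_le_right (Nat.cast_nonneg _) hd))
    _ ≤ _ := Finset.single_le_sum
        (f := fun j : ι → ℕ => (2 : ℝ) ^ (∑ i, (j i : ℝ) * d i))
        (fun j _ => by positivity) hmem

/-- Cost-complexity rate: with `μ = min_i θ i / w i` attained `P`
times, `δ = max_i d i / w i` attained `R` times, `β = μ/δ`, and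
`N(J) = ∑_{j·w ≤ J} 2^{j·d}` the number of degrees of freedom, one has
`2^{-Jμ} J^{P-1} ≲ N(J)^{-β} (log N(J))^{(P-1)+β(R-1)}` for all `J ≥ 2`. -/
theorem sparse_grid_cost_complexity_rate
    (m : ℕ) (hm : 1 ≤ m) (w θ : Fin m → ℝ) (d : Fin m → ℕ)
    (hw : ∀ i, 0 < w i ∧ w i ≤ 1) (hθ : ∀ i, 0 < θ i) (hd : ∀ i, 1 ≤ d i)
    (μ : ℝ) (hμ_le : ∀ i, μ ≤ θ i / w i) (hμ_mem : ∃ i, θ i / w i = μ)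
    (P : ℕ) (hP : P = (Finset.univ.filter fun i => θ i / w i = μ).card)
    (δ : ℝ) (hδ_le : ∀ i, (d i : ℝ) / w i ≤ δ)
    (hδ_mem : ∃ i, (d i : ℝ) / w i = δ)
    (R : ℕ) (hR : R = (Finset.univ.filter fun i => (d i : ℝ) / w i = δ).card)
    (β : ℝ) (hβ : β = μ / δ)
    (A : ℝ → Finset (Fin m → ℕ))
    (hA : ∀ (J : ℝ) (j : Fin m → ℕ), j ∈ A J ↔ ∑ i, (j i : ℝ) * w i ≤ J)
    (N : ℝ → ℝ) (hN : ∀ J, N J = ∑ j ∈ A J, (2 : ℝ) ^ (∑ i, (j i : ℝ) * (d i : ℝ))) :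
    ∃ C : ℝ, 0 < C ∧ ∀ J : ℝ, 2 ≤ J →
      (2 : ℝ) ^ (-(J * μ)) * J ^ (P - 1) ≤
        C * N J ^ (-β) * Real.log (N J) ^ (((P : ℝ) - 1) + β * ((R : ℝ) - 1)) := by
  have hw₀ : ∀ i, 0 < w i := fun i => (hw i).1
  have hd₁ : ∀ i, (1 : ℝ) ≤ d i := fun i => by exact_mod_cast hd i
  have hd₀ : ∀ i, (0 : ℝ) < d i := fun i => one_pos.trans_le (hd₁ i)
  obtain ⟨C, hC, hup⟩ := exists_sum_simplex_rpow_le hw₀ hd₀ hδ_le hδ_mem A hA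
  obtain ⟨i₀, hi₀⟩ := hδ_mem
  obtain ⟨i₁, hi₁⟩ := hμ_mem
  have hδ : 0 < δ := hi₀ ▸ div_pos (hd₀ i₀) (hw₀ i₀)
  have hμ : 0 < μ := hi₁ ▸ div_pos (hθ i₁) (hw₀ i₁)
  have hβ₀ : 0 < β := hβ ▸ div_pos hμ hδ
  have hP₁ : 1 ≤ P := hP ▸ Finset.card_pos.2 ⟨i₁, by simpa using hi₁⟩
  have hR₁ : 1 ≤ R := hR ▸ Finset.card_pos.2 ⟨i₀, by simpa using hi₀⟩
  rw [← hR] at hup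
  have hlog2 : 0 < Real.log 2 := Real.log_pos one_lt_two
  set e : ℝ := ((P : ℝ) - 1) + β * ((R : ℝ) - 1) with he
  have he₀ : 0 ≤ e := by
    have h1 : (1 : ℝ) ≤ P := by exact_mod_cast hP₁
    have h2 : (1 : ℝ) ≤ R := by exact_mod_cast hR₁
    have := mul_nonneg hβ₀.le (sub_nonneg.2 h2)
    linarith
  set c : ℝ := Real.log 2 / 2 with hc
  have hc₀ : 0 < c := by positivity
  refine ⟨C ^ β * (c ^ e)⁻¹, by positivity, fun J hJ => ?_⟩
  have hJ₀ : 0 < J := by linarith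
  have hlogN : c * J ≤ Real.log (N J) := by
    have := half_mul_log_two_le_log_sum_simplex (d := fun i => (d i : ℝ)) i₀ (hw₀ i₀) (hw i₀).2
      (hd₁ i₀) hJ (hA J)
    rw [← hN] at this
    linarith [show c * J = J / 2 * Real.log 2 by rw [hc]; ring]
  have hN₀ : 0 < N J := by
    have h0 : 0 ≤ N J := by rw [hN]; exact Finset.sum_nonneg fun j _ => by positivity
    refine h0.lt_of_ne fun h => ?_
    rw [← h, Real.log_zero] at hlogN
    exact absurd hlogN (not_le.2 (by positivity))
  have hNβ : (C * (2 : ℝ) ^ (δ * J) * J ^ (R - 1)) ^ (-β) ≤ N J ^ (-β) :=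
    Real.rpow_le_rpow_of_nonpos hN₀ (by rw [hN]; exact hup J (by linarith)) (by linarith)
  have hLe : (c * J) ^ e ≤ Real.log (N J) ^ e := Real.rpow_le_rpow (by positivity) hlogN he₀
  have hexpand : (C * (2 : ℝ) ^ (δ * J) * J ^ (R - 1)) ^ (-β) =
      (C ^ β)⁻¹ * (2 : ℝ) ^ (-(J * μ)) * J ^ (-(β * ((R : ℝ) - 1))) := by
    rw [Real.mul_rpow (by positivity) (by positivity), Real.mul_rpow hC.le (by positivity),
      Real.rpow_neg hC.le, ← Real.rpow_mul two_pos.le, ← Real.rpow_natCast J,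
      ← Real.rpow_mul hJ₀.le, Nat.cast_sub hR₁]
    congr 2
    · congr 2
      rw [hβ]
      field_simp
    · push_cast
      ring
  calc (2 : ℝ) ^ (-(J * μ)) * J ^ (P - 1)
      = C ^ β * (c ^ e)⁻¹ *
          ((C * (2 : ℝ) ^ (δ * J) * J ^ (R - 1)) ^ (-β) * (c * J) ^ e) := by
        have hJP : J ^ (P - 1) = J ^ (-(β * ((R : ℝ) - 1))) * J ^ e := by
          rw [← Real.rpow_add hJ₀, ← Real.rpow_natCast J, Nat.cast_sub hP₁, he]
          congr 1
          push_cast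
          ring
        have h1 : C ^ β ≠ 0 := by positivity
        have h2 : c ^ e ≠ 0 := by positivity
        rw [hexpand, Real.mul_rpow hc₀.le hJ₀.le, hJP]
        field_simp
    _ ≤ C ^ β * (c ^ e)⁻¹ * (N J ^ (-β) * Real.log (N J) ^ e) := by gcongr
    _ = _ := by ring
end

section
/- Let m ≥ 1 and let θ, d, w ∈ ℝ^m have all entries positive. Let ℓ ∈ {1, …, m} be an index at which β* := min_{1 ≤ i ≤ m} θ_i/d_i is attained, and assume that θ_ℓ/θ_i ≤ w_ℓ/w_i ≤ d_ℓ/d_i for all i = 1, …, m (condition (3.5)). Then β(w) := (min_{1 ≤ i ≤ m} θ_i/w_i) / (max_{1 ≤ i ≤ m} d_i/w_i) equals β*; i.e., under condition (3.5) the maximal cost-complexity rate β* is achieved. -/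
/-- If `ℓ` attains `β* = min_i θ i / d i` and the weight vector
`w` satisfies condition (3.5), i.e. `θ ℓ / θ i ≤ w ℓ / w i ≤ d ℓ / d i` for all
`i`, then the rate `β(w) = (min_i θ i / w i) / (max_i d i / w i)` equals `β*`. -/
theorem sparse_grid_rate_achieved
    (m : ℕ) (hm : 1 ≤ m) (θ d w : Fin m → ℝ)
    (hθ : ∀ i, 0 < θ i) (hd : ∀ i, 0 < d i) (hw : ∀ i, 0 < w i)
    (hne : (Finset.univ : Finset (Fin m)).Nonempty)
    (ℓ : Fin m) (hℓ : θ ℓ / d ℓ = Finset.univ.inf' hne fun i => θ i / d i)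
    (hcond : ∀ i, θ ℓ / θ i ≤ w ℓ / w i ∧ w ℓ / w i ≤ d ℓ / d i) :
    (Finset.univ.inf' hne fun i => θ i / w i) /
        (Finset.univ.sup' hne fun i => d i / w i) =
      Finset.univ.inf' hne fun i => θ i / d i := by
  have hinf : (Finset.univ.inf' hne fun i => θ i / w i) = θ ℓ / w ℓ := by
    refine le_antisymm (Finset.inf'_le _ (Finset.mem_univ ℓ)) (Finset.le_inf' _ _ fun i _ => ?_)
    have h := (hcond i).1
    rw [div_le_div_iff₀ (hθ i) (hw i)] at h
    rw [div_le_div_iff₀ (hw ℓ) (hw i)]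
    linarith
  have hsup : (Finset.univ.sup' hne fun i => d i / w i) = d ℓ / w ℓ := by
    refine le_antisymm (Finset.sup'_le _ _ fun i _ => ?_)
      (Finset.le_sup' (fun i => d i / w i) (Finset.mem_univ ℓ))
    have h := (hcond i).2
    rw [div_le_div_iff₀ (hw i) (hd i)] at h
    rw [div_le_div_iff₀ (hw i) (hw ℓ)]
    linarith
  rw [hinf, hsup, ← hℓ, div_div_div_cancel_right₀ (hw ℓ).ne']
end

section
/- Let m ≥ 1, let M be an additive commutative group, let Q : ℕ₀^m → M be any family, and for j ∈ ℕ₀^m define P_j := ∑_{ℓ ∈ ℕ₀^m, ℓ ≤ j} Q_ℓ (componentwise partial order, finite sum). Let w ∈ ℝ^m have positive entries and let J ∈ ℝ. Define the combination coefficients c_j := ∑_{j' ∈ {0,1}^m, (j+j')·w ≤ J} (−1)^{|j'|}, where |j'| = ∑_i j'_i. Then ∑_{j ∈ ℕ₀^m, j·w ≤ J} Q_j = ∑_{j ∈ ℕ₀^m, j·w ≤ J} c_j · P_j, where c_j · P_j denotes the ℤ-scalar multiple. (This is the sparse grid combination technique identity (3.9): the sparse grid projection is a signed combination of full tensor product projections.)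 -/
open Finset in
/-- The alternating sum over the binary multi-indices below `d` vanishes unless `d = 0`. -/
lemma sum_neg_one_pow_binary_le {ι : Type*} [Fintype ι] [DecidableEq ι] [DecidableLE (ι → ℕ)]
    (d : ι → ℕ) :
    ∑ ε ∈ Iic (fun _ => 1 : ι → ℕ), (if ε ≤ d then (-1 : ℤ) ^ (∑ i, ε i) else 0) =
      if d = 0 then 1 else 0 := by
  have hset : (Iic (fun _ => 1 : ι → ℕ)).filter (· ≤ d) =
      Fintype.piFinset fun i => Iic (min 1 (d i)) := by
    ext ε
    simp [Pi.le_def, forall_and]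
  have hfactor : ∀ n : ℕ, ∑ e ∈ Iic (min 1 n), (-1 : ℤ) ^ e = if n = 0 then 1 else 0 := by
    rintro (_ | n)
    · rfl
    · have : min 1 (n + 1) = 1 := by omega
      rw [this]
      rfl
  simp_rw [← sum_filter, hset, ← prod_pow_eq_pow_sum]
  rw [← prod_univ_sum (fun i => Iic (min 1 (d i))) (fun _ e => (-1 : ℤ) ^ e)]
  simp_rw [hfactor, prod_ite_zero, prod_const_one, funext_iff, mem_univ, true_imp_iff,
    Pi.zero_apply]

open Finset in
/-- Möbius inversion for multi-indices: `f k` is the alternating binary sum of the partial sums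
of `f` below `k`. -/
lemma sum_binary_smul_sum_Iic {ι : Type*} [Fintype ι] [DecidableEq ι] [DecidableLE (ι → ℕ)]
    {M : Type*} [AddCommGroup M] (f : (ι → ℕ) → M) (k : ι → ℕ) :
    ∑ ε ∈ Iic (fun _ => 1 : ι → ℕ),
      (if ε ≤ k then (-1 : ℤ) ^ (∑ i, ε i) • ∑ l ∈ Iic (k - ε), f l else 0) = f k := by
  have hinner : ∀ ε : ι → ℕ,
      (if ε ≤ k then (-1 : ℤ) ^ (∑ i, ε i) • ∑ l ∈ Iic (k - ε), f l else 0) =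
        ∑ l ∈ Iic k, (if ε ≤ k - l then (-1 : ℤ) ^ (∑ i, ε i) else 0) • f l := by
    intro ε
    simp_rw [ite_smul, zero_smul]
    rw [← sum_filter]
    split_ifs with h
    · rw [smul_sum]
      refine sum_congr ?_ fun _ _ => rfl
      ext l
      simp only [mem_Iic, mem_filter, Pi.le_def, Pi.sub_apply] at h ⊢
      rw [← forall_and]
      refine forall_congr' fun i => ?_
      have := h i
      omega
    · rw [filter_false_of_mem, sum_empty]
      exact fun l _ hl => h (hl.trans tsub_le_self)
  simp_rw [hinner]
  rw [sum_comm]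
  simp_rw [← sum_smul, sum_neg_one_pow_binary_le]
  rw [sum_eq_single_of_mem k (by simp)]
  · simp
  · intro l hl hlk
    rw [if_neg, zero_smul]
    intro h
    exact hlk (le_antisymm (mem_Iic.mp hl) (tsub_eq_zero_iff_le.mp h))

open Finset in
/-- The combination technique on an arbitrary finite lower set of multi-indices. -/
lemma sum_eq_sum_combination_smul_of_isLowerSet {ι : Type*} [Fintype ι] [DecidableEq ι]
    {M : Type*} [AddCommGroup M] (f : (ι → ℕ) → M) (A : Finset (ι → ℕ))
    (hA : IsLowerSet (A : Set (ι → ℕ))) :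
    ∑ j ∈ A, f j = ∑ j ∈ A, (∑ ε ∈ Iic (fun _ => 1 : ι → ℕ),
      if j + ε ∈ A then (-1 : ℤ) ^ (∑ i, ε i) else 0) • ∑ l ∈ Iic j, f l := by
  classical
  calc
    ∑ j ∈ A, f j = ∑ k ∈ A, ∑ ε ∈ Iic (fun _ => 1 : ι → ℕ),
        (if ε ≤ k then (-1 : ℤ) ^ (∑ i, ε i) • ∑ l ∈ Iic (k - ε), f l else 0) :=
      sum_congr rfl fun k _ => (sum_binary_smul_sum_Iic f k).symm
    _ = _ := ?_
  simp_rw [sum_smul, ite_smul, zero_smul]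
  rw [sum_comm, sum_comm (s := A)]
  refine sum_congr rfl fun ε _ => ?_
  rw [← sum_filter, ← sum_filter]
  refine sum_nbij' (· - ε) (· + ε) ?_ ?_ ?_ ?_ ?_
  · intro k hk
    obtain ⟨hkA, hεk⟩ := mem_filter.mp hk
    exact mem_filter.mpr ⟨hA tsub_le_self hkA, by rwa [tsub_add_cancel_of_le hεk]⟩
  · intro j hj
    exact mem_filter.mpr ⟨(mem_filter.mp hj).2, le_add_self⟩
  · exact fun k hk => tsub_add_cancel_of_le (mem_filter.mp hk).2
  · exact fun j _ => add_tsub_cancel_right j ε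
  · exact fun _ _ => rfl


/-- The sparse grid combination technique identity (3.9): for any
family `Q` in an additive commutative group with partial sums
`P j = ∑_{ℓ ≤ j} Q ℓ` and combination coefficients
`c j = ∑_{ε ∈ {0,1}^m, (j+ε)·w ≤ J} (-1)^{|ε|}`, the sparse grid sum
`∑_{j·w ≤ J} Q j` equals the signed combination `∑_{j·w ≤ J} c j • P j`. -/
theorem sparse_grid_combination_technique
    (m : ℕ) (hm : 1 ≤ m) {M : Type*} [AddCommGroup M]
    (Q : (Fin m → ℕ) → M) (P : (Fin m → ℕ) → M)
    (hP : ∀ j, P j = ∑ ℓ ∈ Finset.Iic j, Q ℓ)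
    (w : Fin m → ℝ) (hw : ∀ i, 0 < w i) (J : ℝ)
    (c : (Fin m → ℕ) → ℤ)
    (hc : ∀ j, c j = ∑ ε ∈ Finset.Iic (fun _ => 1 : Fin m → ℕ),
      if ∑ i, ((j + ε) i : ℝ) * w i ≤ J then (-1 : ℤ) ^ (∑ i, ε i) else 0)
    (A : Finset (Fin m → ℕ))
    (hA : ∀ j, j ∈ A ↔ ∑ i, (j i : ℝ) * w i ≤ J) :
    ∑ j ∈ A, Q j = ∑ j ∈ A, c j • P j := by
  have hlower : IsLowerSet (A : Set (Fin m → ℕ)) := by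
    intro a b hba ha
    rw [Finset.mem_coe, hA] at ha ⊢
    refine le_trans (Finset.sum_le_sum fun i _ => ?_) ha
    exact mul_le_mul_of_nonneg_right (Nat.cast_le.mpr (hba i)) (hw i).le
  rw [sum_eq_sum_combination_smul_of_isLowerSet Q A hlower]
  simp_rw [hc, hP, hA]
end
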